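/- Assume K has nonempty interior, let d be the maximum degree of f_1,...,f_m, and define V = {v ∈ ℝ^m : there exists a Borel probability measure μ on ℝ^n with support contained in K, whose moments of order up to d are all finite, such that v_i > ∫ f_i dμ for every i = 1,...,m}. If the set U is convex, then a vector v ∈ f(K) is a weakly Pareto value if and only if v belongs to the topological boundary of the closure cl(V). -/

import Mathlib

open MvPolynomial Filter MeasureTheory

noncomputable section

/-- The feasible set `K` of the multi-objective optimization problem. -/
def mopK (n : ℕ) (E I : Finset ℕ) (c : ℕ → MvPolynomial (Fin n) ℝ) : Set (Fin n → ℝ) :=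
  {x | (∀ i ∈ E, MvPolynomial.eval x (c i) = 0) ∧ ∀ j ∈ I, 0 ≤ MvPolynomial.eval x (c j)}

/-- `xs` is a weakly Pareto point. -/
def isWPP {n m : ℕ} (K : Set (Fin n → ℝ)) (f : Fin m → MvPolynomial (Fin n) ℝ)
    (xs : Fin n → ℝ) : Prop :=
  xs ∈ K ∧ ¬ ∃ x ∈ K, ∀ i, MvPolynomial.eval x (f i) < MvPolynomial.eval xs (f i)

/-- `xs` is a Pareto point. -/
def isPP {n m : ℕ} (K : Set (Fin n → ℝ)) (f : Fin m → MvPolynomial (Fin n) ℝ)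
    (xs : Fin n → ℝ) : Prop :=
  xs ∈ K ∧ ¬ ∃ x ∈ K, (∀ i, MvPolynomial.eval x (f i) ≤ MvPolynomial.eval xs (f i)) ∧
      ∃ j, MvPolynomial.eval x (f j) < MvPolynomial.eval xs (f j)

/-- The epigraph set `U = f(K) + ℝ₊^m`. -/
def mopU {n m : ℕ} (K : Set (Fin n → ℝ)) (f : Fin m → MvPolynomial (Fin n) ℝ) :
    Set (Fin m → ℝ) :=
  {u | ∃ x ∈ K, ∀ i, MvPolynomial.eval x (f i) ≤ u i}

/-- A polynomial is integrable as soon as all monomials up to its total degree are. -/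
theorem integrable_eval_of_integrable_monomials {n d : ℕ} {μ : Measure (Fin n → ℝ)}
    (hμ : ∀ α : Fin n → ℕ, (∑ i, α i) ≤ d →
      Integrable (fun x : Fin n → ℝ => ∏ i, x i ^ α i) μ)
    {p : MvPolynomial (Fin n) ℝ} (hp : p.totalDegree ≤ d) :
    Integrable (fun x => MvPolynomial.eval x p) μ := by
  simp only [MvPolynomial.eval_eq']
  refine integrable_finsetSum _ fun α hα => (hμ α ?_).const_mul _
  have h := MvPolynomial.le_totalDegree hα
  rw [Finsupp.sum_fintype _ _ fun _ => rfl] at h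
  exact h.trans hp

theorem isUpperSet_mopU {n m : ℕ} (K : Set (Fin n → ℝ)) (f : Fin m → MvPolynomial (Fin n) ℝ) :
    IsUpperSet (mopU K f) := by
  rintro u w huw ⟨x, hx, hxu⟩
  exact ⟨x, hx, fun i => (hxu i).trans (huw i)⟩

/-- A vector in the interior of the closure of a set strictly dominates a point of that set. -/
theorem exists_forall_lt_of_mem_interior_closure {m : ℕ} {S : Set (Fin m → ℝ)} {v : Fin m → ℝ}
    (hv : v ∈ interior (closure S)) : ∃ u ∈ S, ∀ i, u i < v i := by
  obtain ⟨ε, hε, hball⟩ := Metric.mem_nhds_iff.1 (mem_interior_iff_mem_nhds.1 hv)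
  have hw : (fun i => v i - ε / 2) ∈ closure S := by
    refine hball ((dist_pi_lt_iff hε).2 fun i => ?_)
    rw [Real.dist_eq, sub_sub_cancel_left, abs_neg, abs_of_pos (half_pos hε)]
    exact half_lt_self hε
  obtain ⟨u, hu, hdist⟩ := Metric.mem_closure_iff.1 hw (ε / 2) (half_pos hε)
  refine ⟨u, hu, fun i => ?_⟩
  have h := (dist_pi_lt_iff (half_pos hε)).1 hdist i
  rw [dist_comm, Real.dist_eq] at h
  linarith [(abs_lt.1 h).2]

/-- A feasible point is weakly Pareto iff its value is not interior to the closure of `U`. -/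
theorem isWPP_iff_notMem_interior_closure_mopU {n m : ℕ} {K : Set (Fin n → ℝ)}
    {f : Fin m → MvPolynomial (Fin n) ℝ} {xs : Fin n → ℝ} (hxs : xs ∈ K) :
    isWPP K f xs ↔ (fun i => MvPolynomial.eval xs (f i)) ∉ interior (closure (mopU K f)) := by
  refine ⟨fun h hint => h.2 ?_, fun h => ⟨hxs, ?_⟩⟩
  · obtain ⟨u, ⟨x, hx, hxu⟩, hu⟩ := exists_forall_lt_of_mem_interior_closure hint
    exact ⟨x, hx, fun i => (hxu i).trans_lt (hu i)⟩
  · rintro ⟨x, hx, hlt⟩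
    refine h (interior_mono subset_closure (mem_interior.2
      ⟨Set.univ.pi fun i => Set.Ioi (MvPolynomial.eval x (f i)), fun w hw => ?_, ?_, ?_⟩))
    · exact ⟨x, hx, fun i => (hw i trivial).le⟩
    · exact isOpen_set_pi Set.finite_univ fun _ _ => isOpen_Ioi
    · exact fun i _ => hlt i

/-- If `U` is convex, the integral of `f` against a probability measure carried by `K` lies in the
closure of `U`. -/
theorem integral_eval_mem_closure_mopU {n m : ℕ} {K : Set (Fin n → ℝ)}
    {f : Fin m → MvPolynomial (Fin n) ℝ} (hU : Convex ℝ (mopU K f)) {μ : Measure (Fin n → ℝ)}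
    [IsProbabilityMeasure μ] (hμK : μ Kᶜ = 0)
    (hint : ∀ i, Integrable (fun x => MvPolynomial.eval x (f i)) μ) :
    (fun i => ∫ x, MvPolynomial.eval x (f i) ∂μ) ∈ closure (mopU K f) := by
  have hmem : ∀ᵐ x ∂μ, (fun i => MvPolynomial.eval x (f i)) ∈ closure (mopU K f) := by
    filter_upwards [mem_ae_iff.2 hμK] with x hx
    exact subset_closure ⟨x, hx, fun _ => le_rfl⟩
  convert hU.closure.integral_mem isClosed_closure hmem (Integrable.of_eval hint) using 1
  funext i
  exact (eval_integral hint i).symm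

/-- Assume `K` has nonempty interior, `d = max deg f_i`, and `V` is the set
of vectors `v` for which there is a Borel probability measure `μ` supported in `K`
(i.e. `μ(Kᶜ) = 0`, `K` being closed), with all moments of order up to `d` finite, such
that `v_i > ∫ f_i dμ` for every `i`. If `U` is convex, then `v ∈ f(K)` is a weakly
Pareto value iff `v` lies on the topological boundary of `cl(V)`. -/
theorem stmt_8 (n m : ℕ) (E I : Finset ℕ) (hEI : Disjoint E I)
    (c : ℕ → MvPolynomial (Fin n) ℝ) (f : Fin m → MvPolynomial (Fin n) ℝ)
    (K : Set (Fin n → ℝ)) (hK : K = mopK n E I c)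
    (hKint : (interior K).Nonempty)
    (d : ℕ) (hd : d = Finset.univ.sup fun i => (f i).totalDegree)
    (V : Set (Fin m → ℝ))
    (hV : V = {v | ∃ μ : Measure (Fin n → ℝ), IsProbabilityMeasure μ ∧ μ Kᶜ = 0 ∧
      (∀ α : Fin n → ℕ, (∑ i, α i) ≤ d →
        Integrable (fun x : Fin n → ℝ => ∏ i, x i ^ α i) μ) ∧
      ∀ i, (∫ x, MvPolynomial.eval x (f i) ∂μ) < v i})
    (hUconv : Convex ℝ (mopU K f))
    (v : Fin m → ℝ) (hv : ∃ x ∈ K, (fun i => MvPolynomial.eval x (f i)) = v) :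
    (∃ xs, isWPP K f xs ∧ (fun i => MvPolynomial.eval xs (f i)) = v)
      ↔ v ∈ frontier (closure V) := by
  have hVU : closure V = closure (mopU K f) := by
    refine (closure_minimal ?_ isClosed_closure).antisymm (closure_minimal ?_ isClosed_closure)
    · rw [hV]
      rintro w ⟨μ, hμ, hμK, hmom, hw⟩
      refine (isUpperSet_mopU K f).closure (fun i => (hw i).le)
        (integral_eval_mem_closure_mopU hUconv hμK fun i =>
          integrable_eval_of_integrable_monomials hmom ?_)
      rw [hd]
      exact Finset.le_sup (f := fun i => (f i).totalDegree) (Finset.mem_univ i)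
    · rintro u ⟨x, hx, hxu⟩
      refine Metric.mem_closure_iff.2 fun ε hε => ⟨fun i => u i + ε / 2, ?_, ?_⟩
      · rw [hV]
        refine ⟨Measure.dirac x, inferInstance, by simp [hx], fun α _ => ?_, fun i => ?_⟩
        · exact integrable_dirac (by simp)
        · rw [integral_dirac]
          linarith [hxu i]
      · refine (dist_pi_lt_iff hε).2 fun i => ?_
        rw [Real.dist_eq, sub_add_cancel_left, abs_neg, abs_of_pos (half_pos hε)]
        exact half_lt_self hε
  obtain ⟨x, hx, rfl⟩ := hv
  have hcl : (fun i => MvPolynomial.eval x (f i)) ∈ closure (mopU K f) :=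
    subset_closure ⟨x, hx, fun _ => le_rfl⟩
  rw [frontier, closure_closure, hVU, Set.mem_sdiff, and_iff_right hcl]
  constructor
  · rintro ⟨xs, hxs, heq⟩
    rw [← heq]
    exact (isWPP_iff_notMem_interior_closure_mopU hxs.1).1 hxs
  · exact fun h => ⟨x, (isWPP_iff_notMem_interior_closure_mopU hx).2 h, rfl⟩
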